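/- arXiv:2605.01370 — 3 statements merged into one kernel-verified Lean document; each statement's English description precedes it below -/
import Mathlib

section
/- Let (Ω_s, μ_s), (Ω_t, μ_t), (Ω_u, μ_u) be probability spaces and let f : Ω_t → Ω_s and g : Ω_u → Ω_t be measurable maps with μ_t.map f ≪ μ_s and μ_u.map g ≪ μ_t. Then, μ_s-almost everywhere, (μ_u.map (f ∘ g)).rnDeriv μ_s = ((μ_t.withDensity ((μ_u.map g).rnDeriv μ_t)).map f).rnDeriv μ_s. (In the paper's notation: dF(j ∘ i) = (𝓔∘F)(i)(dF(j)), where the conditional-expectation transport of a density h along f is the Radon–Nikodym derivative of the pushforward of μ_t.withDensity h.) -/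
open MeasureTheory
open scoped ENNReal

/-- In the paper's notation: `dF(j ∘ i) = (𝓔∘F)(i)(dF(j))`.  For null-preserving measurable
maps `f : Ω_t → Ω_s` and `g : Ω_u → Ω_t` between probability spaces, the Radon–Nikodym
derivative of `μ_u.map (f ∘ g)` with respect to `μ_s` coincides `μ_s`-a.e. with the
conditional-expectation transport along `f` of the density `(μ_u.map g).rnDeriv μ_t`, i.e.
with the Radon–Nikodym derivative of `(μ_t.withDensity ((μ_u.map g).rnDeriv μ_t)).map f`. -/
theorem density_operator_composition_ae {Ωs Ωt Ωu : Type*}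
    [MeasurableSpace Ωs] [MeasurableSpace Ωt] [MeasurableSpace Ωu]
    (μs : Measure Ωs) (μt : Measure Ωt) (μu : Measure Ωu)
    [IsProbabilityMeasure μs] [IsProbabilityMeasure μt] [IsProbabilityMeasure μu]
    (f : Ωt → Ωs) (g : Ωu → Ωt) (hf : Measurable f) (hg : Measurable g)
    (hfs : μt.map f ≪ μs) (hgt : μu.map g ≪ μt) :
    (μu.map (f ∘ g)).rnDeriv μs
      =ᵐ[μs] ((μt.withDensity ((μu.map g).rnDeriv μt)).map f).rnDeriv μs := by
  rw [Measure.withDensity_rnDeriv_eq _ _ hgt, Measure.map_map hf hg]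
end

section
/- Let k ≥ 0 and let M : Fin (k+1) → Type be a family of additive commutative groups with additive homomorphisms T a b : M b →+ M a for a ≤ b satisfying T a a = id and T a b ∘ T b c = T a c for a ≤ b ≤ c. For n ≥ 0 define C^n := the product over all monotone maps θ : Fin (n+1) → Fin (k+1) of M (θ 0), and define δ^{n+1} : C^n → C^{n+1} by δ^{n+1}(c)(θ) := Σ_{ℓ=0}^{n+1} (−1)^ℓ A^θ_ℓ (c(θ∂ℓ)), where A^θ_0 := T (θ 0) (θ 1) and A^θ_ℓ := id for ℓ ≥ 1. Then δ^{n+2} ∘ δ^{n+1} = 0 for every n ≥ 0, so (C^•, δ^•) is a cochain complex. (This is the paper's main proposition that the σ-gauge coboundary operators form a cochain complex.) -/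
open Finset

/-- A monotone map `Fin (n+1) → Fin (k+1)`, i.e. an `n`-simplex of `Δ([n],[k])`. -/
def MonoMap (n k : ℕ) : Type :=
  {f : Fin (n + 1) → Fin (k + 1) // Monotone f}

/-- The `ℓ`-th coface: precomposition with the order embedding omitting `ℓ`. -/
def coface {n k : ℕ} (θ : MonoMap (n + 1) k) (ℓ : Fin (n + 2)) : MonoMap n k :=
  ⟨θ.1 ∘ ℓ.succAbove, θ.2.comp (Fin.strictMono_succAbove ℓ).monotone⟩

/-- The operator `A^θ_ℓ : M ((θ∂ℓ) 0) →+ M (θ 0)`.  Since `(θ∂0) 0 = θ 1` and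
`(θ∂ℓ) 0 = θ 0` for `ℓ ≥ 1`, in the presence of the hypothesis `T a a = id` this is
exactly `A^θ_0 = T (θ 0) (θ 1)` and `A^θ_ℓ = id` for `ℓ ≥ 1`. -/
def Aop {n k : ℕ} (M : Fin (k + 1) → Type) [∀ i, AddCommGroup (M i)]
    (T : ∀ a b : Fin (k + 1), a ≤ b → (M b →+ M a))
    (θ : MonoMap (n + 1) k) (ℓ : Fin (n + 2)) :
    M ((coface θ ℓ).1 0) →+ M (θ.1 0) :=
  T (θ.1 0) (θ.1 (ℓ.succAbove 0)) (θ.2 (Fin.zero_le _))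

/-- The σ-gauge coboundary `δ^{n+1} : C^n → C^{n+1}`,
`δ(c)(θ) = Σ_{ℓ=0}^{n+1} (-1)^ℓ A^θ_ℓ (c (θ∂ℓ))`. -/
def delta {n k : ℕ} (M : Fin (k + 1) → Type) [∀ i, AddCommGroup (M i)]
    (T : ∀ a b : Fin (k + 1), a ≤ b → (M b →+ M a))
    (c : ∀ θ : MonoMap n k, M (θ.1 0)) (θ : MonoMap (n + 1) k) : M (θ.1 0) :=
  ∑ ℓ : Fin (n + 2), (-1 : ℤ) ^ (ℓ : ℕ) • Aop M T θ ℓ (c (coface θ ℓ))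

/-- The cosimplicial identity: removing two vertices does not depend on the order in which
they are removed. -/
theorem coface_coface_succAbove_predAbove {n k : ℕ} (θ : MonoMap (n + 2) k)
    (i : Fin (n + 3)) (j : Fin (n + 2)) :
    coface (coface θ (i.succAbove j)) (j.predAbove i) = coface (coface θ i) j :=
  Subtype.ext <| funext fun l =>
    congrArg θ.1 (Fin.succAbove_succAbove_succAbove_predAbove i j l)

/-- The initial vertex of a monotone map is at most that of any of its iterated faces. -/
theorem le_coface_coface_zero {n k : ℕ} (θ : MonoMap (n + 2) k)
    (i : Fin (n + 3)) (j : Fin (n + 2)) :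
    θ.1 0 ≤ (coface (coface θ i) j).1 0 :=
  θ.2 (Fin.zero_le _)

/-- A sum over pairs of face indices with alternating signs vanishes if the summand is
invariant under exchanging the order of the two faces. -/
theorem sum_neg_one_pow_smul_eq_zero {A : Type*} [AddCommGroup A] {n : ℕ}
    (f : Fin (n + 1) → Fin n → A)
    (hf : ∀ i j, f (i.succAbove j) (j.predAbove i) = f i j) :
    ∑ i : Fin (n + 1), ∑ j : Fin n, (-1 : ℤ) ^ (i + j : ℕ) • f i j = 0 := by
  rw [← Fintype.sum_prod_type' fun (i : Fin (n + 1)) (j : Fin n) => (-1 : ℤ) ^ (i + j : ℕ) • f i j]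
  refine Finset.sum_involution (fun p _ => (p.1.succAbove p.2, p.2.predAbove p.1))
    (fun p _ => ?_) (fun p _ _ h => Fin.succAbove_ne p.1 p.2 (congrArg Prod.fst h))
    (fun _ _ => Finset.mem_univ _) (fun p _ => ?_)
  · rw [hf, Fin.neg_one_pow_succAbove_add_predAbove, neg_smul, add_neg_cancel]
  · exact Prod.ext (Fin.succAbove_succAbove_predAbove p.1 p.2)
      (Fin.predAbove_predAbove_succAbove p.1 p.2)

/-- The σ-gauge coboundary operators form a cochain complex: `δ^{n+2} ∘ δ^{n+1} = 0`. -/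
theorem sigma_gauge_cochain_complex {k : ℕ}
    (M : Fin (k + 1) → Type) [∀ i, AddCommGroup (M i)]
    (T : ∀ a b : Fin (k + 1), a ≤ b → (M b →+ M a))
    (hTid : ∀ a : Fin (k + 1), T a a le_rfl = AddMonoidHom.id (M a))
    (hTcomp : ∀ (a b c : Fin (k + 1)) (hab : a ≤ b) (hbc : b ≤ c),
      (T a b hab).comp (T b c hbc) = T a c (hab.trans hbc))
    (n : ℕ) (c : ∀ θ : MonoMap n k, M (θ.1 0)) (θ : MonoMap (n + 2) k) :
    delta M T (fun θ' => delta M T c θ') θ = 0 := by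
  have transport_eq (ψ φ : MonoMap n k) (h : ψ = φ) (hψ : θ.1 0 ≤ ψ.1 0)
      (hφ : θ.1 0 ≤ φ.1 0) : T _ _ hψ (c ψ) = T _ _ hφ (c φ) := by
    subst h
    rfl
  rw [← sum_neg_one_pow_smul_eq_zero
    (fun i j => T _ _ (le_coface_coface_zero θ i j) (c (coface (coface θ i) j)))
    (fun i j => transport_eq _ _ (coface_coface_succAbove_predAbove θ i j) _ _)]
  refine Finset.sum_congr rfl fun i _ => ?_
  simp only [delta, map_sum, map_zsmul, Finset.smul_sum, smul_smul, ← pow_add]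
  refine Finset.sum_congr rfl fun j _ => congrArg _ ?_
  exact DFunLike.congr_fun (hTcomp _ _ _ _ _) (c (coface (coface θ i) j))
end

section
/- Let k ≥ 0 and let M : Fin (k+1) → Type be a family of additive commutative groups with additive homomorphisms T a b : M b →+ M a for a ≤ b satisfying T a a = id and T a b ∘ T b c = T a c for a ≤ b ≤ c. Let a ∈ C^1 be a 1-cochain satisfying the cocycle identity a(θ∂1) = T (θ 0) (θ 1) (a(θ∂0)) + a(θ∂2) for every monotone θ : Fin 3 → Fin (k+1). Then for every m ≥ 1 and every strictly increasing map θ : Fin (m+1) → Fin (k+1), writing e(p,q) for the 1-simplex Fin 2 → Fin (k+1) with values p and q, one has a(e(θ 0, θ m)) = Σ_{ℓ=0}^{m-1} T (θ 0) (θ ℓ) (a(e(θ ℓ, θ (ℓ+1)))), i.e. the total transport along a path depends only on the composite and is compatible with subdivision. -/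
open Finset

/-- The 1-simplex `e(p,q) : Fin 2 → Fin (k+1)` with values `p` and `q` (`p ≤ q`). -/
def edge {k : ℕ} (p q : Fin (k + 1)) (h : p ≤ q) : MonoMap 1 k :=
  ⟨fun i => if i = 0 then p else q, by
    intro a b hab
    fin_cases a <;> fin_cases b <;> simp_all⟩

/-- The 2-simplex with vertices `p ≤ q ≤ r`. -/
def triangle {k : ℕ} (p q r : Fin (k + 1)) (hpq : p ≤ q) (hqr : q ≤ r) : MonoMap 2 k :=
  ⟨![p, q, r], by
    refine Fin.monotone_iff_le_succ.2 fun i => ?_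
    fin_cases i
    · exact hpq
    · exact hqr⟩

theorem edge_eq_of_apply {k : ℕ} {θ : MonoMap 1 k} {p q : Fin (k + 1)} (h : p ≤ q)
    (h0 : θ.1 0 = p) (h1 : θ.1 1 = q) : θ = edge p q h := by
  refine Subtype.ext (funext fun i => ?_)
  fin_cases i
  · exact h0
  · exact h1

/-- A normalized family satisfying the two-step transport rule satisfies the rule for
arbitrary subdivisions. -/
theorem transport_eq_sum_of_monotone {k : ℕ} {M : Fin (k + 1) → Type}
    [∀ i, AddCommGroup (M i)] (T : ∀ a b : Fin (k + 1), a ≤ b → (M b →+ M a))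
    (b : ∀ p q : Fin (k + 1), p ≤ q → M p) (hzero : ∀ p, b p p le_rfl = 0)
    (hadd : ∀ p q r (hpq : p ≤ q) (hqr : q ≤ r),
      b p r (hpq.trans hqr) = T p q hpq (b q r hqr) + b p q hpq)
    (m : ℕ) (θ : Fin (m + 1) → Fin (k + 1)) (hθ : Monotone θ) :
    b (θ 0) (θ (Fin.last m)) (hθ (Fin.zero_le _)) =
      ∑ ℓ : Fin m, T (θ 0) (θ ℓ.castSucc) (hθ (Fin.zero_le _))
        (b (θ ℓ.castSucc) (θ ℓ.succ) (hθ (Fin.castSucc_le_succ ℓ))) := by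
  induction m with
  | zero => exact hzero (θ 0)
  | succ m ih =>
    rw [Fin.sum_univ_castSucc]
    refine (hadd _ _ _ (hθ (Fin.zero_le (Fin.last m).castSucc)) (hθ (Fin.le_last _))).trans
      ((add_comm _ _).trans ?_)
    exact congrArg (· + _) (ih (θ ∘ Fin.castSucc) (hθ.comp Fin.strictMono_castSucc.monotone))

/-- Transport consistency along subdivided paths: if the 1-cochain `a` satisfies the cocycle
identity `a(θ∂1) = T (θ 0) (θ 1) (a(θ∂0)) + a(θ∂2)` for every monotone `θ : Fin 3 → Fin (k+1)`,
then for every `m ≥ 1` and every strictly increasing `θ : Fin (m+1) → Fin (k+1)`,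
`a(e(θ 0, θ m)) = Σ_{ℓ=0}^{m-1} T (θ 0) (θ ℓ) (a(e(θ ℓ, θ (ℓ+1))))`. -/
theorem transport_consistency {k : ℕ}
    (M : Fin (k + 1) → Type) [∀ i, AddCommGroup (M i)]
    (T : ∀ a b : Fin (k + 1), a ≤ b → (M b →+ M a))
    (hTid : ∀ a : Fin (k + 1), T a a le_rfl = AddMonoidHom.id (M a))
    (hTcomp : ∀ (a b c : Fin (k + 1)) (hab : a ≤ b) (hbc : b ≤ c),
      (T a b hab).comp (T b c hbc) = T a c (hab.trans hbc))
    (a : ∀ θ : MonoMap 1 k, M (θ.1 0))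
    (ha : ∀ θ : MonoMap 2 k,
      (show M (θ.1 0) from a (coface θ 1))
        = T (θ.1 0) (θ.1 1) (θ.2 (Fin.zero_le 1)) (show M (θ.1 1) from a (coface θ 0))
          + (show M (θ.1 0) from a (coface θ 2)))
    (m : ℕ) (hm : 1 ≤ m) (θ : Fin (m + 1) → Fin (k + 1)) (hθ : StrictMono θ) :
    (show M (θ 0) from a (edge (θ 0) (θ (Fin.last m)) (hθ.monotone (Fin.zero_le _))))
      = ∑ ℓ : Fin m,
          T (θ 0) (θ ℓ.castSucc) (hθ.monotone (Fin.zero_le _))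
            (show M (θ ℓ.castSucc) from
              a (edge (θ ℓ.castSucc) (θ ℓ.succ) (hθ.monotone (Fin.castSucc_le_succ ℓ)))) := by
  have hadd : ∀ p q r (hpq : p ≤ q) (hqr : q ≤ r),
      (show M p from a (edge p r (hpq.trans hqr))) =
        T p q hpq (show M q from a (edge q r hqr)) + (show M p from a (edge p q hpq)) := by
    intro p q r hpq hqr
    have h0 : (show M q from a (coface (triangle p q r hpq hqr) 0)) = a (edge q r hqr) :=
      eq_of_heq (congr_arg_heq a (edge_eq_of_apply hqr rfl rfl))
    have h1 : (show M p from a (coface (triangle p q r hpq hqr) 1)) =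
        a (edge p r (hpq.trans hqr)) :=
      eq_of_heq (congr_arg_heq a (edge_eq_of_apply (hpq.trans hqr) rfl rfl))
    have h2 : (show M p from a (coface (triangle p q r hpq hqr) 2)) = a (edge p q hpq) :=
      eq_of_heq (congr_arg_heq a (edge_eq_of_apply hpq rfl rfl))
    exact h1.symm.trans ((ha (triangle p q r hpq hqr)).trans
      (congrArg₂ (· + ·) (congrArg (T p q hpq) h0) h2))
  refine transport_eq_sum_of_monotone T (fun p q h => a (edge p q h)) (fun p => ?_) hadd
    m θ hθ.monotone
  have h := hadd p p p le_rfl le_rfl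
  rw [hTid] at h
  exact left_eq_add.1 h
end
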